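/- Let E₁, E₃ be Banach spaces, 1 ≤ p < 2, X ∈ V^p([0,T],ℝ^n), f : E₁ → L(ℝ^n,E₁) γ-Hölder with 1 + γ > p, and set f_i(y) = f(y)(e_i) for the standard basis e_1,…,e_n of ℝ^n and X^i the coordinates of X. Let Y be a solution of the Young equation dY = Σ_{i=1}^n f_i(Y) dX^i. Then for every twice continuously differentiable F : E₁ → E₃ and all t ∈ [0,T]: F(Y_t) = F(Y_0) + Σ_{i=1}^n ∫_0^t DF(Y_s)(f_i(Y_s)) dX^i_s, all integrals being Young integrals which exist. -/

import Mathlib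

open Set Filter Topology

noncomputable section

/-- The `p`-variation of a path `X : ℝ → E` on the interval `[a,b]`,
`‖X‖_{p,[a,b]} = (sup_D Σ_i ‖X_{t_{i+1}} − X_{t_i}‖^p)^(1/p)`, the supremum being taken
over all finite partitions `a = t₀ ≤ t₁ ≤ … ≤ t_k = b`. -/
def pVar {E : Type*} [NormedAddCommGroup E] (p : ℝ) (X : ℝ → E) (a b : ℝ) : ENNReal :=
  ⨆ (k : ℕ) (t : Fin (k + 1) → ℝ)
    (_ : Monotone t ∧ t 0 = a ∧ t (Fin.last k) = b),
    (∑ i : Fin k, (‖X (t i.succ) - X (t i.castSucc)‖₊ : ENNReal) ^ p) ^ (1 / p)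

/-- `X ∈ V^p([a,b],E)`: `X` is continuous on `[a,b]` and has finite `p`-variation there. -/
def MemVp {E : Type*} [NormedAddCommGroup E] (p : ℝ) (X : ℝ → E) (a b : ℝ) : Prop :=
  ContinuousOn X (Set.Icc a b) ∧ pVar p X a b < ⊤

/-- A partition `a = t₀ ≤ t₁ ≤ … ≤ t_k = b` of `[a,b]`. -/
structure YoungPartition (a b : ℝ) where
  k : ℕ
  t : Fin (k + 1) → ℝ
  mono : Monotone t
  first : t 0 = a
  last : t (Fin.last k) = b

/-- The mesh of a partition. -/
def YoungPartition.mesh {a b : ℝ} (D : YoungPartition a b) : ℝ :=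
  ⨆ i : Fin D.k, (D.t i.succ - D.t i.castSucc)

/-- The Riemann sum `Σ_i Z_{t_i}(X_{t_{i+1}} − X_{t_i})` along a partition. -/
def riemannSum {E F : Type*} [NormedAddCommGroup E] [NormedSpace ℝ E]
    [NormedAddCommGroup F] [NormedSpace ℝ F]
    (Z : ℝ → E →L[ℝ] F) (X : ℝ → E) {a b : ℝ} (D : YoungPartition a b) : F :=
  ∑ i : Fin D.k, Z (D.t i.castSucc) (X (D.t i.succ) - X (D.t i.castSucc))

/-- `IsYoungIntegral Z X a b I` : the Riemann sums of `Z` against `X` over partitions of `[a,b]`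
converge to `I` as the mesh tends to `0`; i.e. the Young integral `∫_a^b Z dX` exists and
equals `I`. -/
def IsYoungIntegral {E F : Type*} [NormedAddCommGroup E] [NormedSpace ℝ E]
    [NormedAddCommGroup F] [NormedSpace ℝ F]
    (Z : ℝ → E →L[ℝ] F) (X : ℝ → E) (a b : ℝ) (I : F) : Prop :=
  Filter.Tendsto (fun D : YoungPartition a b => riemannSum Z X D)
    (Filter.comap YoungPartition.mesh (nhds 0)) (nhds I)

/-- View a vector `v : E` as the continuous linear map `ℝ →L[ℝ] E`, `c ↦ c • v`; used to
integrate vector-valued integrands against scalar integrators. -/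
def toCLM {E : Type*} [NormedAddCommGroup E] [NormedSpace ℝ E] (v : E) : ℝ →L[ℝ] E :=
  (1 : ℝ →L[ℝ] ℝ).smulRight v

/-- The `α`-Hölder seminorm `‖X‖_{α;H} = sup_{s ≠ t ∈ [a,b]} ‖X_t − X_s‖ / |t−s|^α` of a path. -/
def holderSemiPath {E : Type*} [NormedAddCommGroup E] (α : ℝ) (X : ℝ → E) (a b : ℝ) : ENNReal :=
  ⨆ (s : Set.Icc a b) (t : Set.Icc a b) (_ : (s : ℝ) ≠ (t : ℝ)),
    (‖X (t : ℝ) - X (s : ℝ)‖₊ : ENNReal) / edist (s : ℝ) (t : ℝ) ^ α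

/-- The `α`-Hölder norm (sup norm plus Hölder seminorm) of a path on `[a,b]`. -/
def holderNormPath {E : Type*} [NormedAddCommGroup E] (α : ℝ) (X : ℝ → E) (a b : ℝ) : ENNReal :=
  (⨆ t : Set.Icc a b, (‖X (t : ℝ)‖₊ : ENNReal)) + holderSemiPath α X a b

/-- The `γ`-Hölder constant `‖f‖_{γ,H} = sup_{x ≠ y} ‖f x − f y‖ / ‖x − y‖^γ` of a map
between normed spaces. -/
def holderConst {E F : Type*} [NormedAddCommGroup E] [NormedAddCommGroup F]
    (γ : ℝ) (f : E → F) : ENNReal :=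
  ⨆ (x : E) (y : E) (_ : x ≠ y), (‖f x - f y‖₊ : ENNReal) / (‖x - y‖₊ : ENNReal) ^ γ
/-- `Y` is a solution on `[0,T]` of the Young equation `dY = Σ_{i=1}^n f_i(Y) dX^i`
starting at `y₀`, where `f_i(y) = f(y)(e_i)` for the standard basis `e_i` of `ℝ^n` and
`X^i` are the coordinates of `X`: `Y ∈ V^p([0,T],E₁)` and
`Y_t = y₀ + Σ_i ∫_0^t f_i(Y_s) dX^i_s` (Young integrals). -/
def IsYoungSolution {n : ℕ} {E₁ : Type*} [NormedAddCommGroup E₁] [NormedSpace ℝ E₁]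
    (p T : ℝ) (X : ℝ → Fin n → ℝ) (f : E₁ → (Fin n → ℝ) →L[ℝ] E₁)
    (y₀ : E₁) (Y : ℝ → E₁) : Prop :=
  Y 0 = y₀ ∧ MemVp p Y 0 T ∧
  ∀ t ∈ Set.Icc (0 : ℝ) T, ∃ I : Fin n → E₁,
    (∀ i, IsYoungIntegral (fun s => toCLM (f (Y s) (Pi.single i 1)))
      (fun s => X s i) 0 t (I i)) ∧
    Y t = y₀ + ∑ i, I i

/-- A control on `[a,b]`: a nonnegative superadditive function of intervals. -/
structure IsControl (ω : ℝ → ℝ → ℝ) (a b : ℝ) : Prop where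
  nonneg : ∀ s t, 0 ≤ ω s t
  superadd : ∀ s u t, a ≤ s → s ≤ u → u ≤ t → t ≤ b → ω s u + ω u t ≤ ω s t

namespace IsControl

variable {ω ω' : ℝ → ℝ → ℝ} {a b : ℝ}

theorem add (h : IsControl ω a b) (h' : IsControl ω' a b) :
    IsControl (fun s t => ω s t + ω' s t) a b where
  nonneg s t := add_nonneg (h.nonneg s t) (h'.nonneg s t)
  superadd s u t h1 h2 h3 h4 := by
    linarith [h.superadd s u t h1 h2 h3 h4, h'.superadd s u t h1 h2 h3 h4]

theorem mono (h : IsControl ω a b) {s s' t' t : ℝ} (h1 : a ≤ s) (h2 : s ≤ s') (h3 : s' ≤ t')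
    (h4 : t' ≤ t) (h5 : t ≤ b) : ω s' t' ≤ ω s t := by
  linarith [h.superadd s s' t h1 h2 (h3.trans h4) h5,
    h.superadd s' t' t (h1.trans h2) h3 h4 h5, h.nonneg s s', h.nonneg t' t]

theorem sum_le (h : IsControl ω a b) {r : ℕ → ℝ} (hr : Monotone r) (ha : a ≤ r 0) (N : ℕ)
    (hb : r N ≤ b) : ∑ k ∈ Finset.range N, ω (r k) (r (k + 1)) ≤ ω (r 0) (r N) := by
  induction N with
  | zero => simpa using h.nonneg _ _
  | succ N ih =>
    rw [Finset.sum_range_succ]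
    linarith [ih ((hr N.le_succ).trans hb),
      h.superadd (r 0) (r N) (r (N + 1)) ha (hr N.zero_le) (hr N.le_succ) hb]

end IsControl

/-- The sum of an increment function `A` along the first `N` steps of the sequence `r`. -/
def germSum {G : Type*} [AddCommGroup G] (A : ℝ → ℝ → G) (r : ℕ → ℝ) (N : ℕ) : G :=
  ∑ k ∈ Finset.range N, A (r k) (r (k + 1))

/-- Sums of `A` over partitions of a short interval differ from the increment of `A` over the
interval by a small multiple of the control `ω`. -/
def IsSewable {G : Type*} [NormedAddCommGroup G] (ω : ℝ → ℝ → ℝ) (A : ℝ → ℝ → G) (a b : ℝ) :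
    Prop :=
  ∀ η > 0, ∃ δ > 0, ∀ (r : ℕ → ℝ) (N : ℕ), Monotone r → a ≤ r 0 → r N ≤ b → r N - r 0 < δ →
    ‖germSum A r N - A (r 0) (r N)‖ ≤ η * ω (r 0) (r N)

theorem germSum_add {G : Type*} [AddCommGroup G] (A : ℝ → ℝ → G) (r : ℕ → ℝ) (M N : ℕ) :
    germSum A r (M + N) = germSum A r M + germSum A (fun k => r (M + k)) N := by
  simp [germSum, Finset.sum_range_add, add_assoc]

/-- The maximal inequality of the sewing lemma, by dyadic splitting of the control. -/
theorem norm_germSum_sub_le {G : Type*} [NormedAddCommGroup G] {ω : ℝ → ℝ → ℝ} {a b θ c K δ : ℝ}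
    (hω : IsControl ω a b) (hθ : 1 < θ) (hK : 0 ≤ K) (hc : 0 ≤ c)
    (hcK : 2 * c + K * 2 ^ (1 - θ) ≤ K)
    {A : ℝ → ℝ → G} (hA0 : ∀ x, A x x = 0)
    (hA : ∀ s u t, a ≤ s → s ≤ u → u ≤ t → t ≤ b → t - s < δ →
      ‖A s t - A s u - A u t‖ ≤ c * ω s t ^ θ) (N : ℕ) :
    ∀ r : ℕ → ℝ, Monotone r → a ≤ r 0 → r N ≤ b → r N - r 0 < δ →
      ‖germSum A r N - A (r 0) (r N)‖ ≤ K * ω (r 0) (r N) ^ θ := by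
  induction N using Nat.strong_induction_on with
  | _ N ih =>
  intro r hr ha hb hd
  have hnn : 0 ≤ K * ω (r 0) (r N) ^ θ := mul_nonneg hK (Real.rpow_nonneg (hω.nonneg _ _) _)
  rcases Nat.eq_zero_or_pos N with rfl | hN
  · simpa [germSum, hA0] using hnn
  obtain ⟨j, hjN, hj1, hj2⟩ : ∃ j < N, (ω (r 0) (r j) ≤ ω (r 0) (r N) / 2 ∨ j = 0) ∧
      (ω (r (j + 1)) (r N) ≤ ω (r 0) (r N) / 2 ∨ j + 1 = N) := by
    by_cases h : ∃ i, i + 1 < N ∧ ω (r (i + 1)) (r N) ≤ ω (r 0) (r N) / 2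
    · classical
      obtain ⟨h1, h2⟩ := Nat.find_spec h
      refine ⟨Nat.find h, by omega, ?_, .inl h2⟩
      rcases Nat.eq_zero_or_pos (Nat.find h) with h0 | h0
      · exact .inr h0
      · left
        have := Nat.find_min h (m := Nat.find h - 1) (by omega)
        rw [Nat.sub_add_cancel h0] at this
        push Not at this
        have h3 := this (by omega)
        linarith [hω.superadd (r 0) (r (Nat.find h)) (r N) ha (hr (Nat.zero_le _))
          (hr (by omega)) hb]
    · push Not at h
      refine ⟨N - 1, by omega, ?_, .inr (by omega)⟩
      rcases Nat.eq_zero_or_pos (N - 1) with h0 | h0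
      · exact .inr h0
      · left
        have h3 := h (N - 2) (by omega)
        rw [show N - 2 + 1 = N - 1 by omega] at h3
        linarith [hω.superadd (r 0) (r (N - 1)) (r N) ha (hr (Nat.zero_le _))
          (hr (by omega)) hb]
  set W := ω (r 0) (r N) with hW
  have hW0 : 0 ≤ W := hω.nonneg _ _
  have hhalf : K * (W / 2) ^ θ = K * 2 ^ (1 - θ) * W ^ θ / 2 := by
    rw [Real.div_rpow hW0 (by norm_num), Real.rpow_sub (by norm_num), Real.rpow_one]
    field_simp
  have hhalf0 : 0 ≤ K * (W / 2) ^ θ := mul_nonneg hK (Real.rpow_nonneg (by linarith) _)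
  have r0j : r 0 ≤ r j := hr (Nat.zero_le _)
  have rjj : r j ≤ r (j + 1) := hr (Nat.le_succ _)
  have rjN : r (j + 1) ≤ r N := hr hjN
  have e1 : ‖germSum A r j - A (r 0) (r j)‖ ≤ K * (W / 2) ^ θ := by
    rcases hj1 with h | rfl
    · refine (ih j hjN r hr ha (by linarith) (by linarith)).trans ?_
      gcongr
      exact hω.nonneg _ _
    · simpa [germSum, hA0] using hhalf0
  have e2 : ‖germSum A (fun k => r (j + 1 + k)) (N - (j + 1)) - A (r (j + 1)) (r N)‖
      ≤ K * (W / 2) ^ θ := by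
    have hs : j + 1 + (N - (j + 1)) = N := by omega
    rcases hj2 with h | h
    · have := ih (N - (j + 1)) (by omega) (fun k => r (j + 1 + k))
        (fun x y hxy => hr (by omega)) (by simp; linarith) (by simp [hs, hb])
        (by simp only [hs, add_zero]; linarith)
      simp only [hs, add_zero] at this
      refine this.trans ?_
      gcongr
      exact hω.nonneg _ _
    · simpa [germSum, hA0, h] using hhalf0
  have e3 := hA (r 0) (r j) (r N) ha r0j (rjj.trans rjN) hb hd
  have e4 : ‖A (r j) (r N) - A (r j) (r (j + 1)) - A (r (j + 1)) (r N)‖ ≤ c * W ^ θ := by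
    refine (hA _ _ _ (ha.trans r0j) rjj rjN hb (by linarith)).trans ?_
    have := hω.mono ha r0j (rjj.trans rjN) le_rfl hb
    gcongr
    exact hω.nonneg _ _
  have key : germSum A r N - A (r 0) (r N) =
      (germSum A r j - A (r 0) (r j))
      + (germSum A (fun k => r (j + 1 + k)) (N - (j + 1)) - A (r (j + 1)) (r N))
      - (A (r 0) (r N) - A (r 0) (r j) - A (r j) (r N))
      - (A (r j) (r N) - A (r j) (r (j + 1)) - A (r (j + 1)) (r N)) := by
    have := germSum_add A r (j + 1) (N - (j + 1))
    rw [show j + 1 + (N - (j + 1)) = N by omega] at this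
    have h2 : germSum A r (j + 1) = germSum A r j + A (r j) (r (j + 1)) := by
      simp [germSum, Finset.sum_range_succ]
    rw [this, h2]
    abel
  rw [key]
  have hfin : (2 * c + K * 2 ^ (1 - θ)) * W ^ θ ≤ K * W ^ θ := by
    gcongr
  refine (norm_sub_le _ _).trans ?_
  refine (add_le_add_left (norm_sub_le _ _) _).trans ?_
  refine (add_le_add_left (add_le_add_left (norm_add_le _ _) _) _).trans ?_
  linarith

theorem isSewable_of_rpow {G : Type*} [NormedAddCommGroup G] {ω : ℝ → ℝ → ℝ} {a b θ : ℝ}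
    (hω : IsControl ω a b) (hθ : 1 < θ) {A : ℝ → ℝ → G} (hA0 : ∀ x, A x x = 0)
    (hA : ∀ η > 0, ∃ δ > 0, ∀ s u t, a ≤ s → s ≤ u → u ≤ t → t ≤ b → t - s < δ →
      ‖A s t - A s u - A u t‖ ≤ η * ω s t ^ θ) : IsSewable ω A a b := by
  intro η hη
  have h2 : (2 : ℝ) ^ (1 - θ) < 1 := Real.rpow_lt_one_of_one_lt_of_neg (by norm_num) (by linarith)
  have hM : 0 < ω a b ^ (θ - 1) + 1 :=
    add_pos_of_nonneg_of_pos (Real.rpow_nonneg (hω.nonneg _ _) _) one_pos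
  set K := η / (ω a b ^ (θ - 1) + 1) with hK
  have hKpos : 0 < K := div_pos hη hM
  have hc : 0 < K * (1 - 2 ^ (1 - θ)) / 2 := by
    have : 0 < 1 - (2 : ℝ) ^ (1 - θ) := by linarith
    positivity
  obtain ⟨δ, hδ, h⟩ := hA _ hc
  refine ⟨δ, hδ, fun r N hr ha hb hd => ?_⟩
  refine (norm_germSum_sub_le hω hθ hKpos.le hc.le (by linarith) hA0 h N r hr ha hb hd).trans ?_
  have hle : r 0 ≤ r N := hr N.zero_le
  have h0 := hω.nonneg (r 0) (r N)
  have hmono := hω.mono le_rfl ha hle hb le_rfl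
  have e : ω (r 0) (r N) ^ θ ≤ (ω a b ^ (θ - 1) + 1) * ω (r 0) (r N) := by
    have : ω (r 0) (r N) ^ θ = ω (r 0) (r N) ^ (θ - 1) * ω (r 0) (r N) := by
      conv_rhs => rw [← Real.rpow_add_one' h0 (by linarith)]
      simp
    rw [this]
    have h3 : ω (r 0) (r N) ^ (θ - 1) ≤ ω a b ^ (θ - 1) :=
      Real.rpow_le_rpow h0 hmono (by linarith)
    gcongr
    linarith
  calc K * ω (r 0) (r N) ^ θ ≤ K * ((ω a b ^ (θ - 1) + 1) * ω (r 0) (r N)) := by gcongr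
    _ = η * ω (r 0) (r N) := by rw [hK]; field_simp

/-- Truncation of `x` to the interval `[lo, hi]`. -/
def clamp (lo hi x : ℝ) : ℝ := max lo (min hi x)

theorem clamp_monotone (lo hi : ℝ) : Monotone (clamp lo hi) := fun _ _ h =>
  max_le_max le_rfl (min_le_min le_rfl h)

theorem clamp_of_le {lo hi x : ℝ} (h : x ≤ lo) : clamp lo hi x = lo :=
  max_eq_left ((min_le_right _ _).trans h)

theorem clamp_of_ge {lo hi x : ℝ} (h : lo ≤ hi) (hx : hi ≤ x) : clamp lo hi x = hi := by
  rw [clamp, min_eq_left hx, max_eq_right h]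

theorem apply_clamp_comm {G : Type*} [AddCommGroup G] {A : ℝ → ℝ → G} (hA0 : ∀ x, A x x = 0)
    {a b c d : ℝ} (hab : a ≤ b) (hcd : c ≤ d) :
    A (clamp a b c) (clamp a b d) = A (clamp c d a) (clamp c d b) := by
  rcases le_total b c with h | h
  · rw [clamp_of_ge hab h, clamp_of_ge hab (h.trans hcd), clamp_of_le (hab.trans h),
      clamp_of_le h, hA0, hA0]
  rcases le_total d a with h' | h'
  · rw [clamp_of_le h', clamp_of_le (hcd.trans h'), clamp_of_ge hcd h',
      clamp_of_ge hcd (h'.trans hab), hA0, hA0]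
  congr 1
  · rw [clamp, clamp, min_eq_right h, min_eq_right h', max_comm]
  · rw [clamp, clamp, max_eq_right (le_min hab h'), max_eq_right (le_min hcd h), min_comm]

/-- Two partitions of `[a,b]` with small steps have close sums: both are close to the sum over
their common refinement. -/
theorem IsSewable.norm_germSum_sub_germSum_le {G : Type*} [NormedAddCommGroup G]
    {ω : ℝ → ℝ → ℝ} {A : ℝ → ℝ → G} {a b : ℝ} (hA : IsSewable ω A a b)
    (hω : IsControl ω a b) (hA0 : ∀ x, A x x = 0) {η : ℝ} (hη : 0 < η) :
    ∃ δ > 0, ∀ (r r' : ℕ → ℝ) (N N' : ℕ), Monotone r → Monotone r' → r 0 = r' 0 →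
      r N = r' N' → a ≤ r 0 → r N ≤ b → (∀ k < N, r (k + 1) - r k < δ) →
      (∀ k < N', r' (k + 1) - r' k < δ) →
      ‖germSum A r N - germSum A r' N'‖ ≤ 2 * (η * ω (r 0) (r N)) := by
  obtain ⟨δ, hδ, h⟩ := hA η hη
  have key : ∀ (r r' : ℕ → ℝ) (N N' : ℕ), Monotone r → Monotone r' → r 0 = r' 0 →
      r N = r' N' → a ≤ r 0 → r N ≤ b → (∀ k < N, r (k + 1) - r k < δ) →
      ‖∑ i ∈ Finset.range N, ∑ j ∈ Finset.range N',
        A (clamp (r i) (r (i + 1)) (r' j)) (clamp (r i) (r (i + 1)) (r' (j + 1)))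
        - germSum A r N‖ ≤ η * ω (r 0) (r N) := by
    intro r r' N N' hr hr' h0 hN ha hb hs
    rw [germSum, ← Finset.sum_sub_distrib]
    refine (norm_sum_le _ _).trans ?_
    refine le_trans ?_ (mul_le_mul_of_nonneg_left (hω.sum_le hr ha N hb) hη.le)
    rw [Finset.mul_sum]
    refine Finset.sum_le_sum fun i hi => ?_
    have hi := Finset.mem_range.1 hi
    have hi0 : r 0 ≤ r i := hr i.zero_le
    have hi1 : r i ≤ r (i + 1) := hr i.le_succ
    have hi2 : r (i + 1) ≤ r N := hr hi
    have e0 : clamp (r i) (r (i + 1)) (r' 0) = r i := clamp_of_le (h0 ▸ hi0)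
    have e1 : clamp (r i) (r (i + 1)) (r' N') = r (i + 1) := clamp_of_ge hi1 (hN ▸ hi2)
    have := h (fun j => clamp (r i) (r (i + 1)) (r' j)) N' ((clamp_monotone _ _).comp hr')
    simp only [e0, e1] at this
    exact this (ha.trans hi0) (hi2.trans hb) (hs i hi)
  refine ⟨δ, hδ, fun r r' N N' hr hr' h0 hN ha hb hs hs' => ?_⟩
  have h1 := key r r' N N' hr hr' h0 hN ha hb hs
  have h2 := key r' r N' N hr' hr h0.symm hN.symm (h0 ▸ ha) (hN ▸ hb) hs'
  rw [← h0, ← hN, Finset.sum_comm, Finset.sum_congr rfl fun i _ => Finset.sum_congr rfl fun j _ =>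
    apply_clamp_comm hA0 (hr' j.le_succ) (hr i.le_succ)] at h2
  rw [norm_sub_rev] at h1
  calc _ ≤ _ := norm_sub_le_norm_sub_add_norm_sub _ _ _
    _ ≤ _ := add_le_add h1 h2
    _ = _ := by ring

namespace YoungPartition

variable {a b : ℝ}

/-- The partition points, continued by `b`. -/
def seq (D : YoungPartition a b) (n : ℕ) : ℝ := D.t ⟨min n D.k, by omega⟩

theorem seq_monotone (D : YoungPartition a b) : Monotone D.seq := fun _ _ h =>
  D.mono (Fin.mk_le_mk.2 (min_le_min h le_rfl))

theorem seq_zero (D : YoungPartition a b) : D.seq 0 = a :=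
  (congrArg D.t (Fin.ext (by simp))).trans D.first

theorem seq_k (D : YoungPartition a b) : D.seq D.k = b :=
  (congrArg D.t (Fin.ext (by simp))).trans D.last

theorem seq_castSucc (D : YoungPartition a b) (i : Fin D.k) : D.seq i = D.t i.castSucc := by
  have : min (i : ℕ) D.k = i := by omega
  simp only [seq, this]; rfl

theorem seq_succ (D : YoungPartition a b) (i : Fin D.k) : D.seq (i + 1) = D.t i.succ := by
  have : min ((i : ℕ) + 1) D.k = i + 1 := by omega
  simp only [seq, this]; rfl

theorem seq_step_le (D : YoungPartition a b) {n : ℕ} (hn : n < D.k) :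
    D.seq (n + 1) - D.seq n ≤ D.mesh := by
  have h1 := D.seq_succ ⟨n, hn⟩
  have h2 := D.seq_castSucc ⟨n, hn⟩
  simp only at h1 h2
  rw [h1, h2]
  exact le_ciSup (f := fun i : Fin D.k => D.t i.succ - D.t i.castSucc)
    (Set.finite_range _).bddAbove ⟨n, hn⟩

/-- The partition given by the first terms of a monotone sequence. -/
def ofSeq (r : ℕ → ℝ) (N : ℕ) (hr : Monotone r) (h0 : r 0 = a) (hN : r N = b) :
    YoungPartition a b where
  k := N
  t i := r i
  mono _ _ h := hr h
  first := h0
  last := hN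

theorem mesh_nonneg (D : YoungPartition a b) : 0 ≤ D.mesh :=
  Real.iSup_nonneg fun i => sub_nonneg.2 (D.mono i.castSucc_le_succ)

theorem mesh_ofSeq_le {r : ℕ → ℝ} {N : ℕ} (hr : Monotone r) (h0 : r 0 = a) (hN : r N = b)
    {c : ℝ} (hc : 0 ≤ c) (h : ∀ k < N, r (k + 1) - r k ≤ c) : (ofSeq r N hr h0 hN).mesh ≤ c :=
  Real.iSup_le (fun i => h i i.2) hc

theorem tendsto_ofSeq {r : ℕ → ℕ → ℝ} {N : ℕ → ℕ} (hr : ∀ m, Monotone (r m))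
    (h0 : ∀ m, r m 0 = a) (hN : ∀ m, r m (N m) = b) {c : ℕ → ℝ} (hc : Tendsto c atTop (𝓝 0))
    (h : ∀ m, ∀ k < N m, r m (k + 1) - r m k ≤ c m) (hc0 : ∀ m, 0 ≤ c m) :
    Tendsto (fun m => ofSeq (r m) (N m) (hr m) (h0 m) (hN m)) atTop (comap mesh (𝓝 0)) :=
  tendsto_comap_iff.2 <| squeeze_zero (fun _ => mesh_nonneg _)
    (fun m => mesh_ofSeq_le (hr m) (h0 m) (hN m) (hc0 m) (h m)) hc

end YoungPartition

/-- Two consecutive uniform partitions with `N` steps, of `[u,v]` and of `[v,w]`. -/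
def biUniform (u v w : ℝ) (N k : ℕ) : ℝ :=
  u + (v - u) / N * (min k N : ℕ) + (w - v) / N * (k - N : ℕ)

section biUniform

variable {u v w : ℝ}

theorem biUniform_monotone (h : u ≤ v) (h' : v ≤ w) (N : ℕ) : Monotone (biUniform u v w N) := by
  intro k l hkl
  have h1 : ((min k N : ℕ) : ℝ) ≤ (min l N : ℕ) := by exact_mod_cast min_le_min hkl le_rfl
  have h2 : ((k - N : ℕ) : ℝ) ≤ (l - N : ℕ) := by exact_mod_cast Nat.sub_le_sub_right hkl N
  have h3 : 0 ≤ (v - u) / N := div_nonneg (by linarith) (by positivity)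
  have h4 : 0 ≤ (w - v) / N := div_nonneg (by linarith) (by positivity)
  unfold biUniform
  gcongr

theorem biUniform_zero (N : ℕ) : biUniform u v w N 0 = u := by
  simp [biUniform]

theorem biUniform_mid {N : ℕ} (hN : N ≠ 0) : biUniform u v w N N = v := by
  have : (N : ℝ) ≠ 0 := by exact_mod_cast hN
  simp only [biUniform, min_self, Nat.sub_self, Nat.cast_zero]
  field_simp
  ring

theorem biUniform_end {N : ℕ} (hN : N ≠ 0) : biUniform u v w N (N + N) = w := by
  have : (N : ℝ) ≠ 0 := by exact_mod_cast hN
  simp only [biUniform, Nat.add_sub_cancel, min_eq_right (Nat.le_add_left N N)]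
  field_simp
  ring

theorem biUniform_step_le (h : u ≤ v) (h' : v ≤ w) (N k : ℕ) :
    biUniform u v w N (k + 1) - biUniform u v w N k ≤ (w - u) / N := by
  have hN : (0 : ℝ) ≤ N := by positivity
  have h3 : 0 ≤ (v - u) / N := div_nonneg (by linarith) hN
  have h4 : 0 ≤ (w - v) / N := div_nonneg (by linarith) hN
  have h5 : (w - u) / N = (v - u) / N + (w - v) / N := by ring
  rcases lt_or_ge k N with hk | hk
  · have e1 : min (k + 1) N = k + 1 := by omega
    have e2 : min k N = k := by omega
    have e3 : k + 1 - N = 0 := by omega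
    have e4 : k - N = 0 := by omega
    simp only [biUniform, e1, e2, e3, e4]
    push_cast
    linarith
  · have e1 : min (k + 1) N = N := by omega
    have e2 : min k N = N := by omega
    have e3 : k + 1 - N = (k - N) + 1 := by omega
    simp only [biUniform, e1, e2, e3]
    push_cast
    linarith

end biUniform

theorem tendsto_div_succ (c : ℝ) : Tendsto (fun m : ℕ => c / ((m + 1 : ℕ) : ℝ)) atTop (𝓝 0) :=
  (tendsto_const_div_atTop_nhds_zero_nat c).comp (tendsto_add_atTop_nat 1)

/-- Uniform partitions. -/
theorem exists_seq_tendsto_mesh {a b : ℝ} (hab : a ≤ b) :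
    ∃ D : ℕ → YoungPartition a b, Tendsto D atTop (comap YoungPartition.mesh (𝓝 0)) :=
  ⟨_, YoungPartition.tendsto_ofSeq (N := fun m => (m + 1) + (m + 1))
    (fun m => biUniform_monotone hab le_rfl (m + 1)) (fun _ => biUniform_zero _)
    (fun m => biUniform_end m.succ_ne_zero) (tendsto_div_succ (b - a))
    (fun _ k _ => biUniform_step_le hab le_rfl _ k)
    (fun _ => div_nonneg (sub_nonneg.2 hab) (Nat.cast_nonneg _))⟩

/-- The limit of the sums of `A` along partitions of `[a,b]`. -/
def HasGermIntegral {G : Type*} [NormedAddCommGroup G] (A : ℝ → ℝ → G) (a b : ℝ) (I : G) : Prop :=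
  Tendsto (fun D : YoungPartition a b => germSum A D.seq D.k) (comap YoungPartition.mesh (𝓝 0))
    (𝓝 I)

theorem IsSewable.exists_hasGermIntegral {G : Type*} [NormedAddCommGroup G] [CompleteSpace G]
    {ω : ℝ → ℝ → ℝ} {A : ℝ → ℝ → G} {a b : ℝ} (hA : IsSewable ω A a b)
    (hω : IsControl ω a b) (hA0 : ∀ x, A x x = 0) (hab : a ≤ b) :
    ∃ I, HasGermIntegral A a b I := by
  obtain ⟨D₀, hD₀⟩ := exists_seq_tendsto_mesh hab
  have : (comap (YoungPartition.mesh (a := a) (b := b)) (𝓝 0)).NeBot := hD₀.neBot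
  refine cauchy_map_iff_exists_tendsto.1 (Metric.cauchy_iff.2 ⟨inferInstance, fun ε hε => ?_⟩)
  have hM : 0 < 2 * ω a b + 1 := by linarith [hω.nonneg a b]
  obtain ⟨δ, hδ, h⟩ := hA.norm_germSum_sub_germSum_le hω hA0 (div_pos hε hM)
  refine ⟨_, image_mem_map (preimage_mem_comap (Metric.ball_mem_nhds 0 hδ)), ?_⟩
  rintro _ ⟨D, hD, rfl⟩ _ ⟨D', hD', rfl⟩
  have small : ∀ D : YoungPartition a b, D ∈ YoungPartition.mesh ⁻¹' Metric.ball 0 δ →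
      ∀ k < D.k, D.seq (k + 1) - D.seq k < δ := fun D hD k hk =>
    (D.seq_step_le hk).trans_lt (lt_of_abs_lt (by simpa using hD))
  have := h D.seq D'.seq D.k D'.k D.seq_monotone D'.seq_monotone
    (by simp [YoungPartition.seq_zero]) (by simp [YoungPartition.seq_k])
    D.seq_zero.ge D.seq_k.le (small D hD) (small D' hD')
  rw [dist_eq_norm]
  refine this.trans_lt ?_
  rw [D.seq_zero, D.seq_k]
  have e : 2 * (ε / (2 * ω a b + 1) * ω a b) = ε * (2 * ω a b / (2 * ω a b + 1)) := by ring
  rw [e]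
  exact mul_lt_of_lt_one_right hε ((div_lt_one hM).2 (by linarith))

theorem germSum_ofSeq {G : Type*} [AddCommGroup G] (A : ℝ → ℝ → G) {a b : ℝ} {r : ℕ → ℝ} {N : ℕ}
    (hr : Monotone r) (h0 : r 0 = a) (hN : r N = b) :
    germSum A (YoungPartition.ofSeq r N hr h0 hN).seq (YoungPartition.ofSeq r N hr h0 hN).k
      = germSum A r N := by
  refine Finset.sum_congr rfl fun k hk => ?_
  have hk : k < N := Finset.mem_range.1 hk
  have e1 : min (k + 1) N = k + 1 := by omega
  have e2 : min k N = k := by omega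
  simp [YoungPartition.seq, YoungPartition.ofSeq, e1, e2]

/-- Integrals of `A` over `[a,u]` and `[a,v]` differ by the increment `A u v` up to a small
multiple of the control. -/
theorem IsSewable.norm_integral_sub_le {G : Type*} [NormedAddCommGroup G]
    {ω : ℝ → ℝ → ℝ} {A : ℝ → ℝ → G} {a b : ℝ} (hA : IsSewable ω A a b) {I : ℝ → G}
    (hI : ∀ v, a ≤ v → v ≤ b → HasGermIntegral A a v (I v)) {η : ℝ} (hη : 0 < η) :
    ∃ δ > 0, ∀ u v, a ≤ u → u ≤ v → v ≤ b → v - u < δ →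
      ‖I v - I u - A u v‖ ≤ η * ω u v := by
  obtain ⟨δ, hδ, h⟩ := hA η hη
  refine ⟨δ, hδ, fun u v hau huv hvb hd => ?_⟩
  have hr := fun m : ℕ => biUniform_monotone hau huv (m + 1)
  have hc0 : ∀ m : ℕ, 0 ≤ (v - a) / ((m + 1 : ℕ) : ℝ) := fun m =>
    div_nonneg (by linarith) (Nat.cast_nonneg _)
  have hmid := fun m : ℕ => biUniform_mid (u := a) (v := u) (w := v) m.succ_ne_zero
  have hend := fun m : ℕ => biUniform_end (u := a) (v := u) (w := v) m.succ_ne_zero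
  have t1 := (hI u hau (huv.trans hvb)).comp <|
    YoungPartition.tendsto_ofSeq (N := fun m => m + 1) hr (fun _ => biUniform_zero _) hmid
      (tendsto_div_succ (v - a)) (fun _ k _ => biUniform_step_le hau huv _ k) hc0
  have t2 := (hI v (hau.trans huv) hvb).comp <|
    YoungPartition.tendsto_ofSeq (N := fun m => (m + 1) + (m + 1)) hr
      (fun _ => biUniform_zero _) hend
      (tendsto_div_succ (v - a)) (fun _ k _ => biUniform_step_le hau huv _ k) hc0
  refine le_of_tendsto ((t2.sub t1).sub_const (A u v)).norm (Eventually.of_forall fun m => ?_)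
  simp only [Function.comp_apply, germSum_ofSeq, germSum_add A _ (m + 1) (m + 1),
    add_sub_cancel_left]
  have := h (fun k => biUniform a u v (m + 1) (m + 1 + k)) (m + 1)
    (fun k l hkl => hr m (Nat.add_le_add_left hkl _))
  simp only [add_zero, hmid, hend] at this
  exact this hau hvb hd

/-- The fundamental theorem for germ integrals: a germ agreeing with the increments of `Φ` up to
a small multiple of the control integrates to the increment of `Φ`. -/
theorem HasGermIntegral.eq_sub {G : Type*} [NormedAddCommGroup G] {ω : ℝ → ℝ → ℝ}
    {A : ℝ → ℝ → G} {a b : ℝ} (hab : a ≤ b) (hω : IsControl ω a b) {I : G}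
    (hI : HasGermIntegral A a b I) {Φ : ℝ → G}
    (h : ∀ η > 0, ∃ δ > 0, ∀ u v, a ≤ u → u ≤ v → v ≤ b → v - u < δ →
      ‖Φ v - Φ u - A u v‖ ≤ η * ω u v) : I = Φ b - Φ a := by
  obtain ⟨D₀, hD₀⟩ := exists_seq_tendsto_mesh hab
  have : (comap (YoungPartition.mesh (a := a) (b := b)) (𝓝 0)).NeBot := hD₀.neBot
  refine tendsto_nhds_unique hI (tendsto_iff_norm_sub_tendsto_zero.2 ?_)
  refine Metric.tendsto_nhds.2 fun ε hε => ?_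
  have hM : 0 < ω a b + 1 := by linarith [hω.nonneg a b]
  obtain ⟨δ, hδ, h⟩ := h _ (div_pos hε hM)
  filter_upwards [preimage_mem_comap (Metric.ball_mem_nhds 0 hδ)] with D hD
  have e : Φ b - Φ a = ∑ k ∈ Finset.range D.k, (Φ (D.seq (k + 1)) - Φ (D.seq k)) := by
    rw [Finset.sum_range_sub fun k => Φ (D.seq k), D.seq_zero, D.seq_k]
  rw [dist_zero_right, norm_norm, norm_sub_rev, e, germSum, ← Finset.sum_sub_distrib]
  have h1 : ∀ k ∈ Finset.range D.k, ‖Φ (D.seq (k + 1)) - Φ (D.seq k)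
      - A (D.seq k) (D.seq (k + 1))‖ ≤ ε / (ω a b + 1) * ω (D.seq k) (D.seq (k + 1)) := by
    intro k hk
    have hk := Finset.mem_range.1 hk
    refine h _ _ ?_ (D.seq_monotone k.le_succ) ?_
      ((D.seq_step_le hk).trans_lt (lt_of_abs_lt (by simpa using hD)))
    · exact D.seq_zero.ge.trans (D.seq_monotone k.zero_le)
    · exact (D.seq_monotone hk).trans D.seq_k.le
  have h2 := hω.sum_le D.seq_monotone D.seq_zero.ge D.k D.seq_k.le
  rw [D.seq_zero, D.seq_k] at h2
  calc _ ≤ _ := norm_sum_le _ _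
    _ ≤ _ := Finset.sum_le_sum h1
    _ ≤ ε / (ω a b + 1) * ω a b := by
      rw [← Finset.mul_sum]
      have := div_pos hε hM
      gcongr
    _ = ε * (ω a b / (ω a b + 1)) := by ring
    _ < ε := mul_lt_of_lt_one_right hε ((div_lt_one hM).2 (by linarith))

/-- The supremum of the sums `Σ ‖X_{u_{i+1}} − X_{u_i}‖^p` over increasing sequences in `[s,t]`. -/
def varSum {E : Type*} [NormedAddCommGroup E] (p : ℝ) (X : ℝ → E) (s t : ℝ) : ENNReal :=
  ⨆ q : ℕ × {u : ℕ → ℝ // Monotone u ∧ ∀ i, u i ∈ Icc s t},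
    ∑ i ∈ Finset.range q.1, (‖X (q.2.1 (i + 1)) - X (q.2.1 i)‖₊ : ENNReal) ^ p

section varSum

variable {E : Type*} [NormedAddCommGroup E] {p : ℝ} {X : ℝ → E}

theorem sum_le_varSum {s t : ℝ} {u : ℕ → ℝ} (hu : Monotone u) (h : ∀ i, u i ∈ Icc s t) (n : ℕ) :
    ∑ i ∈ Finset.range n, (‖X (u (i + 1)) - X (u i)‖₊ : ENNReal) ^ p ≤ varSum p X s t :=
  le_iSup (fun q : ℕ × {u : ℕ → ℝ // Monotone u ∧ ∀ i, u i ∈ Icc s t} =>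
    ∑ i ∈ Finset.range q.1, (‖X (q.2.1 (i + 1)) - X (q.2.1 i)‖₊ : ENNReal) ^ p)
    (n, ⟨u, hu, h⟩)

theorem varSum_mono {s s' t' t : ℝ} (h1 : s ≤ s') (h2 : t' ≤ t) :
    varSum p X s' t' ≤ varSum p X s t :=
  iSup_le fun ⟨n, _, hu, h⟩ => sum_le_varSum hu (fun i => Icc_subset_Icc h1 h2 (h i)) n

theorem varSum_add_le {s u t : ℝ} (hsu : s ≤ u) (hut : u ≤ t) :
    varSum p X s u + varSum p X u t ≤ varSum p X s t := by
  have const : ∀ {a b : ℝ}, a ≤ b →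
      Nonempty (ℕ × {u : ℕ → ℝ // Monotone u ∧ ∀ i, u i ∈ Icc a b}) := fun {a b} h =>
    ⟨0, fun _ => a, monotone_const, fun _ => ⟨le_rfl, h⟩⟩
  have := const hsu
  have := const hut
  refine ENNReal.iSup_add_iSup_le fun ⟨n, v, hv, h⟩ ⟨m, w, hw, h'⟩ => ?_
  set r : ℕ → ℝ := fun i => if i ≤ n then v i else w (i - (n + 1)) with hr
  have hrm : Monotone r := by
    intro i j hij
    simp only [hr]
    split_ifs with h1 h2 h2
    · exact hv hij
    · exact (h i).2.trans (h' _).1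
    · omega
    · exact hw (by omega)
  refine le_trans ?_ (sum_le_varSum hrm (fun i => ?_) (n + 1 + m))
  · rw [Finset.sum_range_add _ (n + 1) m, Finset.sum_range_succ]
    refine add_le_add (le_add_right (Finset.sum_le_sum fun i hi => ?_))
      (Finset.sum_le_sum fun i hi => ?_)
    · have := Finset.mem_range.1 hi
      simp [hr, this.le, Nat.succ_le_of_lt this]
    · have h1 : r (n + 1 + i + 1) = w (i + 1) := by
        simp only [hr]
        rw [if_neg (by omega), show n + 1 + i + 1 - (n + 1) = i + 1 by omega]
      have h2 : r (n + 1 + i) = w i := by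
        simp only [hr]
        rw [if_neg (by omega), Nat.add_sub_cancel_left]
      rw [h1, h2]
  · simp only [hr]
    split_ifs
    · exact ⟨(h i).1, (h i).2.trans hut⟩
    · exact ⟨hsu.trans (h' _).1, (h' _).2⟩

theorem varSum_le_pVar_rpow (hp : 0 < p) (X : ℝ → E) (a b : ℝ) :
    varSum p X a b ≤ pVar p X a b ^ p := by
  refine iSup_le fun ⟨n, u, hu, h⟩ => ?_
  set r : ℕ → ℝ := fun i => if i = 0 then a else if i ≤ n + 1 then u (i - 1) else b with hr
  have hrm : Monotone r := by
    refine monotone_nat_of_le_succ fun i => ?_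
    rcases Nat.eq_zero_or_pos i with rfl | hi
    · simpa [hr] using (h 0).1
    · simp only [hr, hi.ne', if_false, Nat.succ_ne_zero]
      split_ifs
      · exact hu (by omega)
      · exact (h _).2
      · omega
      · exact le_rfl
  have hP : Monotone (fun i : Fin (n + 2 + 1) => r i) ∧ r (0 : Fin (n + 2 + 1)) = a ∧
      r (Fin.last (n + 2)) = b := ⟨fun i j hij => hrm hij, by simp [hr], by simp [hr]⟩
  have h1 : (∑ i : Fin (n + 2), (‖X (r (i.succ : ℕ)) - X (r (i.castSucc : ℕ))‖₊ : ENNReal) ^ p)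
      ^ (1 / p) ≤ pVar p X a b :=
    le_iSup_of_le (n + 2) <| le_iSup_of_le (fun i : Fin (n + 2 + 1) => r i) <|
      le_iSup_of_le hP le_rfl
  have h2 := ENNReal.rpow_le_rpow h1 hp.le
  rw [← ENNReal.rpow_mul, one_div_mul_cancel hp.ne', ENNReal.rpow_one] at h2
  refine le_trans ?_ h2
  simp only [Fin.val_succ, Fin.val_castSucc]
  rw [Fin.sum_univ_eq_sum_range
    (fun i => (‖X (r (i + 1)) - X (r i)‖₊ : ENNReal) ^ p) (n + 2), Finset.sum_range_succ,
    Finset.sum_range_succ']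
  refine le_add_right (le_add_right (Finset.sum_le_sum fun i hi => ?_))
  have := Finset.mem_range.1 hi
  have h3 : i + 1 + 1 ≤ n + 1 := by omega
  have h4 : i + 1 ≤ n + 1 := by omega
  simp [hr, this.le, Nat.succ_le_of_lt this]

/-- A path of finite `p`-variation has a control dominating the `p`-th powers of its
increments. -/
theorem MemVp.exists_control {a b : ℝ} (hp : 0 < p) (hX : MemVp p X a b) :
    ∃ ω : ℝ → ℝ → ℝ, IsControl ω a b ∧
      ∀ s t, a ≤ s → s ≤ t → t ≤ b → ‖X t - X s‖ ^ p ≤ ω s t := by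
  have fin : ∀ s t, a ≤ s → t ≤ b → varSum p X s t ≠ ⊤ := fun s t hs ht =>
    ((varSum_mono hs ht).trans_lt ((varSum_le_pVar_rpow hp X a b).trans_lt
      (ENNReal.rpow_lt_top_of_nonneg hp.le hX.2.ne))).ne
  refine ⟨fun s t => (varSum p X s t).toReal, ⟨fun _ _ => ENNReal.toReal_nonneg,
    fun s u t h1 h2 h3 h4 => ?_⟩, fun s t h1 h2 h3 => ?_⟩
  · rw [← ENNReal.toReal_add (fin s u h1 (h3.trans h4)) (fin u t (h1.trans h2) h4)]
    exact ENNReal.toReal_mono (fin s t h1 h4) (varSum_add_le h2 h3)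
  · have hm : Monotone fun i : ℕ => if i = 0 then s else t := by
      refine monotone_nat_of_le_succ fun i => ?_
      by_cases hi : i = 0 <;> simp [hi, h2]
    have := ENNReal.toReal_mono (fin s t h1 h3) (sum_le_varSum (p := p) (X := X) (s := s) (t := t)
      hm (fun i => by by_cases hi : i = 0 <;> simp [hi, h2]) 1)
    simpa [← ENNReal.toReal_rpow] using this

end varSum

/-- Uniform continuity on a compact interval, in `ε`–`δ` form. -/
theorem ContinuousOn.exists_norm_sub_lt {E : Type*} [NormedAddCommGroup E] {X : ℝ → E} {a b : ℝ}
    (hX : ContinuousOn X (Icc a b)) {ε : ℝ} (hε : 0 < ε) :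
    ∃ δ > 0, ∀ s t, a ≤ s → s ≤ t → t ≤ b → t - s < δ → ‖X t - X s‖ < ε := by
  obtain ⟨δ, hδ, h⟩ := Metric.uniformContinuousOn_iff.1
    (isCompact_Icc.uniformContinuousOn_of_continuous hX) ε hε
  refine ⟨δ, hδ, fun s t h1 h2 h3 h4 => ?_⟩
  have := h t ⟨h1.trans h2, h3⟩ s ⟨h1, h2.trans h3⟩
    (by rw [Real.dist_eq, abs_of_nonneg (by linarith)]; exact h4)
  rwa [dist_eq_norm] at this

theorem exists_pos_mul_rpow_le {C ε η : ℝ} (hC : 0 ≤ C) (hε : 0 < ε) (hη : 0 < η) :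
    ∃ x > 0, C * x ^ ε ≤ η := by
  have h : 0 < η / (C + 1) := by positivity
  refine ⟨(η / (C + 1)) ^ ε⁻¹, by positivity, ?_⟩
  rw [Real.rpow_inv_rpow h.le hε.ne']
  calc C * (η / (C + 1)) ≤ (C + 1) * (η / (C + 1)) := by gcongr; linarith
    _ = η := by field_simp

/-- The germ `Z_s(X_t − X_s)` is sewable when `Z` is controlled by the `γ`-th power of a path of
finite `p`-variation and `1 + γ > p`. -/
theorem isSewable_apply_sub {E E' G : Type*} [NormedAddCommGroup E] [NormedSpace ℝ E]
    [NormedAddCommGroup E'] [NormedAddCommGroup G] [NormedSpace ℝ G] {p γ a b C : ℝ} (hp1 : 1 ≤ p)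
    (hγ0 : 0 < γ) (hγ1 : γ ≤ 1) (hγp : p < 1 + γ) {ω : ℝ → ℝ → ℝ} (hω : IsControl ω a b)
    {X : ℝ → E} (hX : ContinuousOn X (Icc a b))
    (hXω : ∀ s t, a ≤ s → s ≤ t → t ≤ b → ‖X t - X s‖ ^ p ≤ ω s t)
    {Y : ℝ → E'} (hYω : ∀ s t, a ≤ s → s ≤ t → t ≤ b → ‖Y t - Y s‖ ^ p ≤ ω s t)
    {Z : ℝ → E →L[ℝ] G} (hC : 0 ≤ C)
    (hZ : ∀ s t, a ≤ s → s ≤ t → t ≤ b → ‖Z t - Z s‖ ≤ C * ‖Y t - Y s‖ ^ γ) :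
    IsSewable ω (fun s t => Z s (X t - X s)) a b := by
  have hp0 : 0 < p := by linarith
  set ε := (1 + γ - p) / 2 with hε
  have hε0 : 0 < ε := by rw [hε]; linarith
  have hε1 : 0 ≤ 1 - ε := by rw [hε]; linarith
  have hθ : 1 < (1 - ε) / p + γ / p := by
    rw [← add_div, lt_div_iff₀ hp0, hε]; linarith
  have root : ∀ {x w β : ℝ}, 0 ≤ x → 0 ≤ β → x ^ p ≤ w → x ^ β ≤ w ^ (β / p) := by
    intro x w β hx hβ h
    have := Real.rpow_le_rpow (Real.rpow_nonneg hx p) h (div_nonneg hβ hp0.le)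
    rwa [← Real.rpow_mul hx, mul_div_cancel₀ _ hp0.ne'] at this
  refine isSewable_of_rpow hω hθ (by simp) fun η hη => ?_
  obtain ⟨x, hx, hxη⟩ := exists_pos_mul_rpow_le hC hε0 hη
  obtain ⟨δ, hδ, h⟩ := hX.exists_norm_sub_lt hx
  refine ⟨δ, hδ, fun s u t h1 h2 h3 h4 h5 => ?_⟩
  have e : Z s (X t - X s) - Z s (X u - X s) - Z u (X t - X u) = -((Z u - Z s) (X t - X u)) := by
    simp only [map_sub, sub_apply]
    abel
  have hW := hω.nonneg s t
  have hXtu : ‖X t - X u‖ ^ p ≤ ω s t :=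
    (hXω u t (h1.trans h2) h3 h4).trans (hω.mono h1 h2 h3 le_rfl h4)
  have hYus : ‖Y u - Y s‖ ^ p ≤ ω s t :=
    (hYω s u h1 h2 (h3.trans h4)).trans (hω.mono h1 le_rfl h2 h3 h4)
  have hsmall : ‖X t - X u‖ ≤ x := (h u t (h1.trans h2) h3 h4 (by linarith)).le
  have split : ‖X t - X u‖ = ‖X t - X u‖ ^ ε * ‖X t - X u‖ ^ (1 - ε) := by
    rw [← Real.rpow_add_of_nonneg (norm_nonneg _) hε0.le hε1]; simp
  rw [e, norm_neg]
  calc ‖(Z u - Z s) (X t - X u)‖ ≤ ‖Z u - Z s‖ * ‖X t - X u‖ := ContinuousLinearMap.le_opNorm _ _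
    _ ≤ C * ‖Y u - Y s‖ ^ γ * ‖X t - X u‖ := by
      gcongr; exact hZ s u h1 h2 (h3.trans h4)
    _ = C * ‖X t - X u‖ ^ ε * (‖X t - X u‖ ^ (1 - ε) * ‖Y u - Y s‖ ^ γ) := by
      conv_lhs => rw [split]
      ring
    _ ≤ C * x ^ ε * (ω s t ^ ((1 - ε) / p) * ω s t ^ (γ / p)) := by
      gcongr
      · exact root (norm_nonneg _) hε1 hXtu
      · exact root (norm_nonneg _) hγ0.le hYus
    _ ≤ η * ω s t ^ ((1 - ε) / p + γ / p) := by
      rw [Real.rpow_add_of_nonneg hW (div_nonneg hε1 hp0.le) (div_nonneg hγ0.le hp0.le)]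
      gcongr

theorem isYoungIntegral_iff {E G : Type*} [NormedAddCommGroup E] [NormedSpace ℝ E]
    [NormedAddCommGroup G] [NormedSpace ℝ G] {Z : ℝ → E →L[ℝ] G} {X : ℝ → E} {a b : ℝ} {I : G} :
    IsYoungIntegral Z X a b I ↔ HasGermIntegral (fun s t => Z s (X t - X s)) a b I := by
  have : ∀ D : YoungPartition a b,
      riemannSum Z X D = germSum (fun s t => Z s (X t - X s)) D.seq D.k := fun D => by
    simp only [germSum, riemannSum, Finset.sum_range, D.seq_succ, D.seq_castSucc]
  simp only [IsYoungIntegral, HasGermIntegral, this]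

/-- The sum of the coordinate Young integrals is the integral against the whole path. -/
theorem hasGermIntegral_sum_coordinates {n : ℕ} {G : Type*} [NormedAddCommGroup G]
    [NormedSpace ℝ G] {Z : ℝ → (Fin n → ℝ) →L[ℝ] G} {X : ℝ → Fin n → ℝ} {a b : ℝ}
    {I : Fin n → G}
    (h : ∀ i, IsYoungIntegral (fun s => toCLM (Z s (Pi.single i 1))) (fun s => X s i) a b (I i)) :
    HasGermIntegral (fun s t => Z s (X t - X s)) a b (∑ i, I i) := by
  have := tendsto_finsetSum Finset.univ fun i _ => isYoungIntegral_iff.1 (h i)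
  refine this.congr fun D => ?_
  simp only [germSum]
  rw [Finset.sum_comm]
  refine Finset.sum_congr rfl fun k _ => ?_
  have e := LinearMap.pi_apply_eq_sum_univ (Z (D.seq k) : (Fin n → ℝ) →ₗ[ℝ] G)
    (X (D.seq (k + 1)) - X (D.seq k))
  rw [ContinuousLinearMap.coe_coe] at e
  rw [e]
  refine Finset.sum_congr rfl fun i _ => ?_
  simp only [toCLM, ContinuousLinearMap.smulRight_apply, one_apply_eq_self,
    Pi.sub_apply]
  congr 3
  ext j
  simp [Pi.single_apply, eq_comm]

/-- On a compact set a `C²` map has Lipschitz derivative and a second-order Taylor bound. -/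
theorem ContDiff.exists_taylor_bound {E G : Type*} [NormedAddCommGroup E] [NormedSpace ℝ E]
    [CompleteSpace E] [NormedAddCommGroup G] [NormedSpace ℝ G] {F : E → G} (hF : ContDiff ℝ 2 F)
    {K : Set E} (hK : IsCompact K) :
    ∃ L, 0 ≤ L ∧ ∀ x ∈ K, ∀ y ∈ K, ‖fderiv ℝ F y - fderiv ℝ F x‖ ≤ L * ‖y - x‖ ∧
      ‖F y - F x - fderiv ℝ F x (y - x)‖ ≤ L * ‖y - x‖ ^ 2 := by
  set S := closure (convexHull ℝ K) with hS
  have hSc : IsCompact S :=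
    isCompact_iff_totallyBounded_isComplete.2
      ⟨hK.totallyBounded.convexHull.closure, isClosed_closure.isComplete⟩
  have hSconv : Convex ℝ S := (convex_convexHull ℝ K).closure
  have hKS : K ⊆ S := (subset_convexHull ℝ K).trans subset_closure
  have hF' : ContDiff ℝ 1 (fderiv ℝ F) := hF.fderiv_right (by norm_num)
  obtain ⟨L, hL⟩ := hSc.exists_bound_of_continuousOn
    (hF'.continuous_fderiv one_ne_zero).continuousOn
  have lip : ∀ x ∈ S, ∀ y ∈ S, ‖fderiv ℝ F y - fderiv ℝ F x‖ ≤ max L 0 * ‖y - x‖ :=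
    fun x hx y hy => hSconv.norm_image_sub_le_of_norm_fderiv_le
      (fun z _ => (hF'.differentiable one_ne_zero).differentiableAt)
      (fun z hz => (hL z hz).trans (le_max_left _ _)) hx hy
  refine ⟨max L 0, le_max_right _ _, fun x hx y hy => ⟨lip x (hKS hx) y (hKS hy), ?_⟩⟩
  have hseg : segment ℝ x y ⊆ S := hSconv.segment_subset (hKS hx) (hKS hy)
  have := (convex_segment x y).norm_image_sub_le_of_norm_fderiv_le' (f := F)
    (φ := fderiv ℝ F x) (C := max L 0 * ‖y - x‖)
    (fun z _ => (hF.differentiable two_ne_zero).differentiableAt)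
    (fun z hz => (lip x (hKS hx) z (hseg hz)).trans
      (mul_le_mul_of_nonneg_left (norm_sub_le_of_mem_segment hz) (le_max_right _ _)))
    (left_mem_segment ℝ x y) (right_mem_segment ℝ x y)
  rwa [mul_assoc, ← sq] at this

/-- If `D`, `g` are operator-valued paths bounded on `[a,b]`, with increments bounded by powers
`1` and `γ ≤ 1` of those of a bounded path `Y`, then so is `D ∘ g` with power `γ`. -/
theorem exists_norm_comp_sub_le {V E G E' : Type*} [NormedAddCommGroup V] [NormedSpace ℝ V]
    [NormedAddCommGroup E] [NormedSpace ℝ E] [NormedAddCommGroup G] [NormedSpace ℝ G]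
    [NormedAddCommGroup E'] {s : Set ℝ} {γ B L C M M' : ℝ} (hγ0 : 0 ≤ γ) (hγ1 : γ ≤ 1)
    (hL : 0 ≤ L) (hM : 0 ≤ M) (hM' : 0 ≤ M')
    {Y : ℝ → E'} {D : ℝ → E →L[ℝ] G} {g : ℝ → V →L[ℝ] E}
    (hY : ∀ u ∈ s, ∀ v ∈ s, ‖Y v - Y u‖ ≤ B) (hB : 0 ≤ B)
    (hDM : ∀ u ∈ s, ‖D u‖ ≤ M) (hgM : ∀ u ∈ s, ‖g u‖ ≤ M')
    (hD : ∀ u ∈ s, ∀ v ∈ s, ‖D v - D u‖ ≤ L * ‖Y v - Y u‖)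
    (hg : ∀ u ∈ s, ∀ v ∈ s, ‖g v - g u‖ ≤ C * ‖Y v - Y u‖ ^ γ) (hC : 0 ≤ C) :
    ∃ C', 0 ≤ C' ∧ ∀ u ∈ s, ∀ v ∈ s,
      ‖(D v).comp (g v) - (D u).comp (g u)‖ ≤ C' * ‖Y v - Y u‖ ^ γ := by
  refine ⟨L * B ^ (1 - γ) * M' + M * C, by positivity, fun u hu v hv => ?_⟩
  have e : (D v).comp (g v) - (D u).comp (g u)
      = (D v - D u).comp (g v) + (D u).comp (g v - g u) := by
    ext x; simp
  have split : ‖Y v - Y u‖ ≤ B ^ (1 - γ) * ‖Y v - Y u‖ ^ γ := by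
    have : ‖Y v - Y u‖ = ‖Y v - Y u‖ ^ (1 - γ) * ‖Y v - Y u‖ ^ γ := by
      rw [← Real.rpow_add_of_nonneg (norm_nonneg _) (by linarith) hγ0]; simp
    refine this.le.trans ?_
    gcongr
    exact hY u hu v hv
  have hL' := (hD u hu v hv).trans (mul_le_mul_of_nonneg_left split hL)
  rw [e]
  calc _ ≤ ‖D v - D u‖ * ‖g v‖ + ‖D u‖ * ‖g v - g u‖ :=
      (norm_add_le _ _).trans (add_le_add (ContinuousLinearMap.opNorm_comp_le _ _)
        (ContinuousLinearMap.opNorm_comp_le _ _))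
    _ ≤ (L * (B ^ (1 - γ) * ‖Y v - Y u‖ ^ γ)) * M' + M * (C * ‖Y v - Y u‖ ^ γ) := by
      gcongr
      · exact hgM v hv
      · exact hDM u hu
      · exact hg u hu v hv
    _ = _ := by ring

/-- The Itô formula on the whole interval, for paths dominated by a control. -/
theorem young_ito_of_control
    {n : ℕ} {E₁ E₃ : Type*} [NormedAddCommGroup E₁] [NormedSpace ℝ E₁] [CompleteSpace E₁]
    [NormedAddCommGroup E₃] [NormedSpace ℝ E₃] [CompleteSpace E₃]
    {p γ T : ℝ} (hp1 : 1 ≤ p) (hp2 : p < 2) (hγ0 : 0 < γ) (hγ1 : γ ≤ 1)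
    (hγp : p < 1 + γ) (hT : 0 ≤ T) {ω : ℝ → ℝ → ℝ} (hω : IsControl ω 0 T)
    {X : ℝ → Fin n → ℝ} (hX : ContinuousOn X (Icc 0 T))
    (hXω : ∀ s t, 0 ≤ s → s ≤ t → t ≤ T → ‖X t - X s‖ ^ p ≤ ω s t)
    {f : E₁ → (Fin n → ℝ) →L[ℝ] E₁} {C : ℝ} (hC : 0 ≤ C)
    (hf : ∀ x y : E₁, ‖f x - f y‖ ≤ C * ‖x - y‖ ^ γ)
    {Y : ℝ → E₁} (hY : ContinuousOn Y (Icc 0 T))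
    (hYω : ∀ s t, 0 ≤ s → s ≤ t → t ≤ T → ‖Y t - Y s‖ ^ p ≤ ω s t)
    (hsol : ∀ v, 0 ≤ v → v ≤ T →
      HasGermIntegral (fun s t => f (Y s) (X t - X s)) 0 v (Y v - Y 0))
    {F : E₁ → E₃} (hF : ContDiff ℝ 2 F) :
    ∃ J : Fin n → E₃,
      (∀ i, IsYoungIntegral
        (fun s => toCLM (fderiv ℝ F (Y s) (f (Y s) (Pi.single i 1))))
        (fun s => X s i) 0 T (J i)) ∧
      F (Y T) = F (Y 0) + ∑ i, J i := by
  have hK : IsCompact (Y '' Icc 0 T) := isCompact_Icc.image_of_continuousOn hY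
  obtain ⟨L, hL, hFL⟩ := hF.exists_taylor_bound hK
  obtain ⟨M, hM⟩ := hK.exists_bound_of_continuousOn
    (hF.continuous_fderiv two_ne_zero).continuousOn
  obtain ⟨B, hB⟩ := hK.exists_bound_of_continuousOn continuousOn_id
  have h0 : (0 : ℝ) ∈ Icc 0 T := ⟨le_rfl, hT⟩
  have hB0 : 0 ≤ B := (norm_nonneg _).trans (hB _ (mem_image_of_mem Y h0))
  have hM0 : 0 ≤ M := (norm_nonneg _).trans (hM _ (mem_image_of_mem Y h0))
  have hYB : ∀ u ∈ Icc 0 T, ∀ v ∈ Icc 0 T, ‖Y v - Y u‖ ≤ B + B := fun u hu v hv =>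
    (norm_sub_le _ _).trans
      (add_le_add (hB _ (mem_image_of_mem Y hv)) (hB _ (mem_image_of_mem Y hu)))
  obtain ⟨C', hC', hDf⟩ := exists_norm_comp_sub_le (D := fun s => fderiv ℝ F (Y s))
    (g := fun s => f (Y s)) (Y := Y) (s := Icc 0 T) (M' := ‖f (Y 0)‖ + C * (B + B) ^ γ)
    hγ0.le hγ1 hL hM0 (by positivity) hYB (by positivity)
    (fun u hu => hM _ (mem_image_of_mem Y hu))
    (fun u hu => by
      have h1 := norm_le_norm_add_norm_sub' (f (Y u)) (f (Y 0))
      have h2 : C * ‖Y u - Y 0‖ ^ γ ≤ C * (B + B) ^ γ := by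
        gcongr; exact hYB 0 h0 u hu
      linarith [hf (Y u) (Y 0)])
    (fun u hu v hv => (hFL _ (mem_image_of_mem Y hu) _ (mem_image_of_mem Y hv)).1)
    (fun u _ v _ => hf (Y v) (Y u)) hC
  have hint : ∀ i, ∃ J, IsYoungIntegral
      (fun s => toCLM (fderiv ℝ F (Y s) (f (Y s) (Pi.single i 1)))) (fun s => X s i) 0 T J := by
    intro i
    simp only [isYoungIntegral_iff]
    refine IsSewable.exists_hasGermIntegral (ω := ω) (isSewable_apply_sub hp1 hγ0 hγ1 hγp hω
      ((continuous_apply i).comp_continuousOn hX) (fun s t h1 h2 h3 => ?_) hYω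
      (C := C' * ‖(Pi.single i 1 : Fin n → ℝ)‖) (by positivity) fun s t h1 h2 h3 => ?_)
      hω (by simp) hT
    · refine le_trans ?_ (hXω s t h1 h2 h3)
      have := norm_le_pi_norm (X t - X s) i
      rw [Pi.sub_apply] at this
      gcongr
      exact this
    · have e : ∀ v w : E₃, ‖toCLM v - toCLM w‖ ≤ ‖v - w‖ := fun v w =>
        ContinuousLinearMap.opNorm_le_bound _ (norm_nonneg _) fun x => by
          simp [toCLM, ← smul_sub, norm_smul, mul_comm]
      refine (e _ _).trans ?_
      have h4 := hDf s ⟨h1, h2.trans h3⟩ t ⟨h1.trans h2, h3⟩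
      have h5 := ((fderiv ℝ F (Y t)).comp (f (Y t))
        - (fderiv ℝ F (Y s)).comp (f (Y s))).le_opNorm (Pi.single i 1)
      simp only [sub_apply, ContinuousLinearMap.comp_apply] at h5
      refine h5.trans ((mul_le_mul_of_nonneg_right h4 (norm_nonneg _)).trans (le_of_eq ?_))
      ring
  choose J hJ using hint
  refine ⟨J, hJ, ?_⟩
  have hJsum := hasGermIntegral_sum_coordinates
    (Z := fun s => (fderiv ℝ F (Y s)).comp (f (Y s))) hJ
  have hsew := isSewable_apply_sub hp1 hγ0 hγ1 hγp hω hX hXω hYω (Z := fun s => f (Y s)) hC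
    (fun s t _ _ _ => hf (Y t) (Y s))
  rw [hJsum.eq_sub hT hω (Φ := fun s => F (Y s)), add_sub_cancel]
  intro η hη
  obtain ⟨δ, hδ, h⟩ := hsew.norm_integral_sub_le (I := fun v => Y v - Y 0) hsol
    (η := η / 2 / (M + 1)) (by positivity)
  obtain ⟨x, hx, hxη⟩ := exists_pos_mul_rpow_le hL (sub_pos.2 hp2) (half_pos hη)
  obtain ⟨δ', hδ', h'⟩ := hY.exists_norm_sub_lt hx
  refine ⟨min δ δ', lt_min hδ hδ', fun u v h1 h2 h3 h4 => ?_⟩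
  have hu : Y u ∈ Y '' Icc 0 T := mem_image_of_mem Y ⟨h1, h2.trans h3⟩
  have hv : Y v ∈ Y '' Icc 0 T := mem_image_of_mem Y ⟨h1.trans h2, h3⟩
  have a1 := (hFL _ hu _ hv).2
  have a2 := h u v h1 h2 h3 (h4.trans_le (min_le_left _ _))
  have a3 := (h' u v h1 h2 h3 (h4.trans_le (min_le_right _ _))).le
  have hWpos := hω.nonneg u v
  rw [sub_sub_sub_cancel_right] at a2
  have key : F (Y v) - F (Y u) - ((fderiv ℝ F (Y u)).comp (f (Y u))) (X v - X u)
      = (F (Y v) - F (Y u) - fderiv ℝ F (Y u) (Y v - Y u))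
        + fderiv ℝ F (Y u) (Y v - Y u - f (Y u) (X v - X u)) := by
    simp only [map_sub, ContinuousLinearMap.comp_apply]
    abel
  have b1 : L * ‖Y v - Y u‖ ^ 2 ≤ η / 2 * ω u v := by
    have : ‖Y v - Y u‖ ^ 2 = ‖Y v - Y u‖ ^ (2 - p) * ‖Y v - Y u‖ ^ p := by
      rw [← Real.rpow_add_of_nonneg (norm_nonneg _) (by linarith) (by linarith), sub_add_cancel,
        Real.rpow_two]
    rw [this, ← mul_assoc]
    refine mul_le_mul (le_trans ?_ hxη) (hYω u v h1 h2 h3) (by positivity) (by positivity)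
    have : 0 ≤ 2 - p := by linarith
    gcongr
  have b2 : ‖fderiv ℝ F (Y u) (Y v - Y u - f (Y u) (X v - X u))‖ ≤ η / 2 * ω u v :=
    calc _ ≤ ‖fderiv ℝ F (Y u)‖ * ‖Y v - Y u - f (Y u) (X v - X u)‖ :=
          ContinuousLinearMap.le_opNorm _ _
      _ ≤ (M + 1) * (η / 2 / (M + 1) * ω u v) := by
        gcongr
        linarith [hM _ hu]
      _ = η / 2 * ω u v := by field_simp
  rw [key]
  linarith [norm_add_le (F (Y v) - F (Y u) - fderiv ℝ F (Y u) (Y v - Y u))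
    (fderiv ℝ F (Y u) (Y v - Y u - f (Y u) (X v - X u)))]

/-- For a solution `Y` of `dY = Σ_i f_i(Y) dX^i` and any twice continuously differentiable
`F : E₁ → E₃`, `F(Y_t) = F(Y_0) + Σ_i ∫_0^t DF(Y_s)(f_i(Y_s)) dX^i_s`, all Young integrals
existing. -/
theorem young_ito_formula_coordinates
    {n : ℕ} {E₁ E₃ : Type*} [NormedAddCommGroup E₁] [NormedSpace ℝ E₁] [CompleteSpace E₁]
    [NormedAddCommGroup E₃] [NormedSpace ℝ E₃] [CompleteSpace E₃]
    (p γ T : ℝ) (hp1 : 1 ≤ p) (hp2 : p < 2) (hγ0 : 0 < γ) (hγ1 : γ ≤ 1)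
    (hγp : 1 + γ > p) (hT : 0 ≤ T)
    (X : ℝ → Fin n → ℝ) (hX : MemVp p X 0 T)
    (f : E₁ → (Fin n → ℝ) →L[ℝ] E₁)
    (hf : ∃ C : ℝ, ∀ x y : E₁, ‖f x - f y‖ ≤ C * ‖x - y‖ ^ γ)
    (y₀ : E₁) (Y : ℝ → E₁) (hY : IsYoungSolution p T X f y₀ Y)
    (F : E₁ → E₃) (hF : ContDiff ℝ 2 F) :
    ∀ t ∈ Set.Icc (0 : ℝ) T, ∃ J : Fin n → E₃,
      (∀ i, IsYoungIntegral
        (fun s => toCLM (fderiv ℝ F (Y s) (f (Y s) (Pi.single i 1))))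
        (fun s => X s i) 0 t (J i)) ∧
      F (Y t) = F (Y 0) + ∑ i, J i := by
  intro t ht
  obtain ⟨C, hC⟩ := hf
  obtain ⟨hY0, hYV, hsol⟩ := hY
  have hp0 : 0 < p := by linarith
  obtain ⟨ω, hω, hXω⟩ := hX.exists_control hp0
  obtain ⟨ω', hω', hYω⟩ := hYV.exists_control hp0
  have hω'' := hω.add hω'
  refine young_ito_of_control hp1 hp2 hγ0 hγ1 hγp ht.1
    ⟨hω''.nonneg, fun s u v h1 h2 h3 h4 => hω''.superadd s u v h1 h2 h3 (h4.trans ht.2)⟩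
    (hX.1.mono (Icc_subset_Icc le_rfl ht.2))
    (fun s u h1 h2 h3 => ?_) (le_max_right C 0) (fun x y => (hC x y).trans ?_)
    (hYV.1.mono (Icc_subset_Icc le_rfl ht.2)) (fun s u h1 h2 h3 => ?_)
    (fun v h1 h2 => ?_) hF
  · exact (hXω s u h1 h2 (h3.trans ht.2)).trans (le_add_of_nonneg_right (hω'.nonneg _ _))
  · gcongr
    exact le_max_left _ _
  · exact (hYω s u h1 h2 (h3.trans ht.2)).trans (le_add_of_nonneg_left (hω.nonneg _ _))
  · obtain ⟨I, hI, hIY⟩ := hsol v ⟨h1, h2.trans ht.2⟩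
    rw [hY0, hIY, add_sub_cancel_left]
    exact hasGermIntegral_sum_coordinates (Z := fun s => f (Y s)) hI
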